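/- Let N ≥ 1, let ρ be a positive semidefinite matrix on ℂ² ⊗ ℂ^N, and let α, β be reals satisfying α ≥ max(-1, β/2 - 1) and β ≥ max(-1, α/2 - 1). Then Tr(ρ)·𝟙_{2N} + α·ρ + β·ρ̃_A is separable. -/

import Mathlib

open Matrix Kronecker
open scoped ComplexOrder

noncomputable section

/-- A Hermitian matrix on ℂ^M ⊗ ℂ^N is separable if it is a finite sum of Kronecker
products of positive semidefinite matrices. -/
def IsSeparableMat {M N : ℕ} (σ : Matrix (Fin M × Fin N) (Fin M × Fin N) ℂ) : Prop :=
  ∃ (k : ℕ) (A : Fin k → Matrix (Fin M) (Fin M) ℂ) (B : Fin k → Matrix (Fin N) (Fin N) ℂ),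
    (∀ i, (A i).PosSemidef) ∧ (∀ i, (B i).PosSemidef) ∧ σ = ∑ i, A i ⊗ₖ B i

/-- Partial transpose on the first (Alice) factor. -/
def ptA {M N : ℕ} (ρ : Matrix (Fin M × Fin N) (Fin M × Fin N) ℂ) :
    Matrix (Fin M × Fin N) (Fin M × Fin N) ℂ :=
  fun p q => ρ (q.1, p.2) (p.1, q.2)

/-- Partial transpose on the second (Bob) factor. -/
def ptB {M N : ℕ} (ρ : Matrix (Fin M × Fin N) (Fin M × Fin N) ℂ) :
    Matrix (Fin M × Fin N) (Fin M × Fin N) ℂ :=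
  fun p q => ρ (p.1, q.2) (q.1, p.2)

/-- The second Pauli matrix σ₂. -/
def pauli2 : Matrix (Fin 2) (Fin 2) ℂ := !![0, -Complex.I; Complex.I, 0]

/-- ρ̃_A = (σ₂ ⊗ 𝟙_N) ρ^{T_A} (σ₂ ⊗ 𝟙_N). -/
def tildeA {N : ℕ} (ρ : Matrix (Fin 2 × Fin N) (Fin 2 × Fin N) ℂ) :
    Matrix (Fin 2 × Fin N) (Fin 2 × Fin N) ℂ :=
  (pauli2 ⊗ₖ (1 : Matrix (Fin N) (Fin N) ℂ)) * ptA ρ *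
    (pauli2 ⊗ₖ (1 : Matrix (Fin N) (Fin N) ℂ))

end

namespace IsSeparableMat

variable {M N : ℕ}

lemma kronecker {A : Matrix (Fin M) (Fin M) ℂ} {B : Matrix (Fin N) (Fin N) ℂ}
    (hA : A.PosSemidef) (hB : B.PosSemidef) : IsSeparableMat (A ⊗ₖ B) :=
  ⟨1, fun _ => A, fun _ => B, fun _ => hA, fun _ => hB, by simp⟩

lemma zero : IsSeparableMat (0 : Matrix (Fin M × Fin N) (Fin M × Fin N) ℂ) :=
  ⟨0, fun _ => 0, fun _ => 0, fun i => i.elim0, fun i => i.elim0, by simp⟩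

lemma add {σ τ : Matrix (Fin M × Fin N) (Fin M × Fin N) ℂ}
    (hσ : IsSeparableMat σ) (hτ : IsSeparableMat τ) : IsSeparableMat (σ + τ) := by
  obtain ⟨k, A, B, hA, hB, rfl⟩ := hσ
  obtain ⟨l, A', B', hA', hB', rfl⟩ := hτ
  refine ⟨k + l, Fin.append A A', Fin.append B B', fun i => ?_, fun i => ?_, ?_⟩
  · refine Fin.addCases (fun i => ?_) (fun i => ?_) i
    · simpa using hA i
    · simpa using hA' i
  · refine Fin.addCases (fun i => ?_) (fun i => ?_) i
    · simpa using hB i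
    · simpa using hB' i
  · simp [Fin.sum_univ_add]

lemma sum {ι : Type*} (s : Finset ι) {σ : ι → Matrix (Fin M × Fin N) (Fin M × Fin N) ℂ}
    (h : ∀ i ∈ s, IsSeparableMat (σ i)) : IsSeparableMat (∑ i ∈ s, σ i) :=
  Finset.sum_induction _ IsSeparableMat (fun _ _ => add) zero h

lemma smul {σ : Matrix (Fin M × Fin N) (Fin M × Fin N) ℂ}
    (hσ : IsSeparableMat σ) {c : ℝ} (hc : 0 ≤ c) : IsSeparableMat ((c : ℂ) • σ) := by
  obtain ⟨k, A, B, hA, hB, rfl⟩ := hσ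
  refine ⟨k, fun i => (c : ℂ) • A i, B, fun i => (hA i).smul (by exact_mod_cast hc), hB, ?_⟩
  simp [Finset.smul_sum, smul_kronecker]

lemma conj_kronecker_one {σ : Matrix (Fin M × Fin N) (Fin M × Fin N) ℂ}
    (hσ : IsSeparableMat σ) (U : Matrix (Fin M) (Fin M) ℂ) :
    IsSeparableMat ((U ⊗ₖ (1 : Matrix (Fin N) (Fin N) ℂ)) * σ *
      (Uᴴ ⊗ₖ (1 : Matrix (Fin N) (Fin N) ℂ))) := by
  obtain ⟨k, A, B, hA, hB, rfl⟩ := hσ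
  refine ⟨k, fun i => U * A i * Uᴴ, B, fun i => (hA i).mul_mul_conjTranspose_same U, hB, ?_⟩
  simp [Finset.mul_sum, Finset.sum_mul, ← mul_kronecker_mul]

lemma ptA {σ : Matrix (Fin M × Fin N) (Fin M × Fin N) ℂ}
    (hσ : IsSeparableMat σ) : IsSeparableMat (ptA σ) := by
  obtain ⟨k, A, B, hA, hB, rfl⟩ := hσ
  refine ⟨k, fun i => (A i)ᵀ, B, fun i => (hA i).transpose, hB, ?_⟩
  ext p q
  simp [_root_.ptA, Matrix.sum_apply]

lemma tildeA {σ : Matrix (Fin 2 × Fin N) (Fin 2 × Fin N) ℂ}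
    (hσ : IsSeparableMat σ) : IsSeparableMat (tildeA σ) := by
  have h : pauli2ᴴ = pauli2 := by
    ext i j; fin_cases i <;> fin_cases j <;> simp [pauli2]
  have hU := hσ.ptA.conj_kronecker_one pauli2
  rwa [h] at hU

end IsSeparableMat

section

variable {N : ℕ}

/-- The reduction-map form of `tildeA`. -/
lemma tildeA_apply (ρ : Matrix (Fin 2 × Fin N) (Fin 2 × Fin N) ℂ) (p q : Fin 2 × Fin N) :
    tildeA ρ p q = (if p.1 = q.1 then ∑ i, ρ (i, p.2) (i, q.2) else 0) - ρ p q := by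
  obtain ⟨i, j⟩ := p
  obtain ⟨k, l⟩ := q
  simp only [tildeA, Matrix.mul_apply, Fintype.sum_prod_type, kroneckerMap_apply, ptA,
    Matrix.one_apply]
  fin_cases i <;> fin_cases k <;>
    simp [pauli2, Fin.sum_univ_two, mul_ite, ite_mul] <;> ring_nf <;> simp

lemma tildeA_add (ρ σ : Matrix (Fin 2 × Fin N) (Fin 2 × Fin N) ℂ) :
    tildeA (ρ + σ) = tildeA ρ + tildeA σ := by
  ext p q
  simp only [tildeA_apply, Matrix.add_apply, Finset.sum_add_distrib]
  split_ifs <;> ring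

lemma tildeA_smul (c : ℂ) (ρ : Matrix (Fin 2 × Fin N) (Fin 2 × Fin N) ℂ) :
    tildeA (c • ρ) = c • tildeA ρ := by
  ext p q
  simp only [tildeA_apply, Matrix.smul_apply, smul_eq_mul, ← Finset.mul_sum]
  split_ifs <;> ring

lemma tildeA_one : tildeA (1 : Matrix (Fin 2 × Fin N) (Fin 2 × Fin N) ℂ) = 1 := by
  ext ⟨i, j⟩ ⟨k, l⟩
  simp only [tildeA_apply, Matrix.one_apply, Prod.mk.injEq, Fin.sum_univ_two]
  fin_cases i <;> fin_cases k <;> by_cases h : j = l <;> simp [h]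

lemma tildeA_tildeA (ρ : Matrix (Fin 2 × Fin N) (Fin 2 × Fin N) ℂ) :
    tildeA (tildeA ρ) = ρ := by
  ext ⟨i, j⟩ ⟨k, l⟩
  simp only [tildeA_apply, Fin.sum_univ_two]
  fin_cases i <;> fin_cases k <;> simp

/-- The compression `⟨a| ρ |a⟩` of `ρ` along a vector of the first factor. -/
def compressA (ρ : Matrix (Fin 2 × Fin N) (Fin 2 × Fin N) ℂ) (a : Fin 2 → ℂ) :
    Matrix (Fin N) (Fin N) ℂ :=
  fun j l => ∑ i, ∑ k, star (a i) * ρ (i, j) (k, l) * a k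

lemma compressA_posSemidef {ρ : Matrix (Fin 2 × Fin N) (Fin 2 × Fin N) ℂ}
    (hρ : ρ.PosSemidef) (a : Fin 2 → ℂ) : (compressA ρ a).PosSemidef := by
  let C : Matrix (Fin N) (Fin 2 × Fin N) ℂ :=
    .of fun j p => if j = p.2 then star (a p.1) else 0
  have h : compressA ρ a = C * ρ * Cᴴ := by
    ext j l
    simp [compressA, C, Matrix.mul_apply, Fintype.sum_prod_type, apply_ite]
    ring
  rw [h]
  exact hρ.mul_mul_conjTranspose_same C

/-- The projective 2-design of Pauli eigenvectors gives a product decomposition. -/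
lemma isSeparableMat_two_smul_add_tildeA {ρ : Matrix (Fin 2 × Fin N) (Fin 2 × Fin N) ℂ}
    (hρ : ρ.PosSemidef) : IsSeparableMat ((2 : ℂ) • ρ + tildeA ρ) := by
  have key (a : Fin 2 → ℂ) : IsSeparableMat (vecMulVec a (star a) ⊗ₖ compressA ρ a) :=
    .kronecker (posSemidef_vecMulVec_self_star a) (compressA_posSemidef hρ a)
  have h := ((key ![1, 0]).add (key ![0, 1])).add
    (((((key ![1, 1]).add (key ![1, -1])).add (key ![1, Complex.I])).add
      (key ![1, -Complex.I])).smul (c := 1 / 4) (by norm_num))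
  convert h using 1
  ext ⟨i, j⟩ ⟨k, l⟩
  simp only [tildeA_apply, Matrix.add_apply, Matrix.smul_apply, smul_eq_mul, kroneckerMap_apply,
    vecMulVec_apply, compressA, Fin.sum_univ_two]
  fin_cases i <;> fin_cases k <;> simp <;> ring_nf <;> simp <;> ring

/-- The matrix `|ψ⟩⟨ψ|` of the vector `ψ` with coordinates `V i j`. -/
def pureMat (V : Matrix (Fin 2) (Fin N) ℂ) : Matrix (Fin 2 × Fin N) (Fin 2 × Fin N) ℂ :=
  fun p q => V p.1 p.2 * star (V q.1 q.2)

lemma trace_pureMat (V : Matrix (Fin 2) (Fin N) ℂ) :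
    (pureMat V).trace = (V * Vᴴ).trace := by
  simp [pureMat, Matrix.trace, Matrix.mul_apply, Fintype.sum_prod_type]

lemma pureMat_mul (U : Matrix (Fin 2) (Fin 2) ℂ) (V : Matrix (Fin 2) (Fin N) ℂ) :
    pureMat (U * V) = (U ⊗ₖ (1 : Matrix (Fin N) (Fin N) ℂ)) * pureMat V *
      (Uᴴ ⊗ₖ (1 : Matrix (Fin N) (Fin N) ℂ)) := by
  ext ⟨i, j⟩ ⟨k, l⟩
  simp [pureMat, Matrix.mul_apply, Fintype.sum_prod_type, Matrix.one_apply]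
  ring

open scoped MatrixOrder Matrix.Norms.L2Operator in
lemma exists_eq_sum_pureMat {ρ : Matrix (Fin 2 × Fin N) (Fin 2 × Fin N) ℂ}
    (hρ : ρ.PosSemidef) :
    ∃ V : Fin 2 × Fin N → Matrix (Fin 2) (Fin N) ℂ, ρ = ∑ k, pureMat (V k) := by
  obtain ⟨B, hB⟩ := CStarAlgebra.nonneg_iff_eq_star_mul_self.mp hρ.nonneg
  refine ⟨fun k i j => star (B k (i, j)), ?_⟩
  ext p q
  rw [hB, Matrix.sum_apply]
  simp [pureMat, Matrix.mul_apply]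

/-- Every vector is a multiple of a vector of norm `0` or `1`. -/
lemma exists_normalization (v : Fin N → ℂ) :
    ∃ (s : ℝ) (f : Fin N → ℂ), v = (s : ℂ) • f ∧ v ⬝ᵥ star v = (s : ℂ) * s ∧
      (f ⬝ᵥ star f) • f = f ∧ ∃ c : ℂ, f = c • v := by
  have hnn : 0 ≤ ∑ j, Complex.normSq (v j) := Finset.sum_nonneg fun j _ => Complex.normSq_nonneg _
  have hv : v ⬝ᵥ star v = ((∑ j, Complex.normSq (v j) : ℝ) : ℂ) := by
    simp [dotProduct, Complex.mul_conj]
  set p := ∑ j, Complex.normSq (v j)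
  have hs : (√p : ℂ) * √p = p := by exact_mod_cast Real.mul_self_sqrt hnn
  by_cases hp : p = 0
  · have : v = 0 := by
      rw [hp] at hv
      exact dotProduct_star_self_eq_zero.mp (by simpa using hv)
    exact ⟨0, 0, by simp [this], by simp [this], by simp, 0, by simp⟩
  · have h0 : (√p : ℂ) ≠ 0 := by
      simpa using (Real.sqrt_ne_zero hnn).mpr hp
    refine ⟨√p, (√p : ℂ)⁻¹ • v, by simp [smul_smul, h0], by rw [hv, hs], ?_, _, rfl⟩
    have : ((√p : ℂ)⁻¹ • v) ⬝ᵥ star ((√p : ℂ)⁻¹ • v) = 1 := by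
      simp [hv, ← hs, h0]
    rw [this, one_smul]

lemma posSemidef_one_sub {n : Type*} [Fintype n] [DecidableEq n] {P : Matrix n n ℂ}
    (hP : P.IsHermitian) (hPP : P * P = P) : (1 - P).PosSemidef := by
  have h : 1 - P = (1 - P)ᴴ * (1 - P) := by
    rw [conjTranspose_sub, conjTranspose_one, hP.eq, sub_mul, mul_sub, mul_sub, hPP]
    simp
  rw [h]
  exact posSemidef_conjTranspose_mul_self _

lemma isHermitian_vecMulVec_star {n : Type*} (f : n → ℂ) :
    (vecMulVec f (star f)).IsHermitian := by
  ext i j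
  simp [vecMulVec_apply, mul_comm]

lemma vecMulVec_star_mul_self {f : Fin N → ℂ} (hf : (f ⬝ᵥ star f) • f = f) :
    vecMulVec f (star f) * vecMulVec f (star f) = vecMulVec f (star f) := by
  rw [vecMulVec_mul_vecMulVec, dotProduct_comm]
  ext i j
  have := congrFun hf i
  simp only [Pi.smul_apply, smul_eq_mul, vecMulVec_apply] at this ⊢
  linear_combination star f j * this

/-- The operators `1 - (z |f⟩⟨g| + h.c.)` are positive for orthonormal `f`, `g` and `|z| = 1`. -/
lemma posSemidef_one_sub_cross {f g : Fin N → ℂ} (hf : (f ⬝ᵥ star f) • f = f)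
    (hg : (g ⬝ᵥ star g) • g = g) (hfg : f ⬝ᵥ star g = 0) {z : ℂ} (hz : star z * z = 1) :
    (1 - z • vecMulVec f (star g) - star z • vecMulVec g (star f)).PosSemidef := by
  have hgf : g ⬝ᵥ star f = 0 := by
    rw [dotProduct_comm, star_dotProduct, dotProduct_comm, hfg, star_zero]
  have h1 : vecMulVec f (star f) * vecMulVec g (star g) = 0 := by
    rw [vecMulVec_mul_vecMulVec, dotProduct_comm, hgf]; simp
  have h2 : vecMulVec g (star g) * vecMulVec f (star f) = 0 := by
    rw [vecMulVec_mul_vecMulVec, dotProduct_comm, hfg]; simp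
  have hP := posSemidef_one_sub
    ((isHermitian_vecMulVec_star f).add (isHermitian_vecMulVec_star g)) (by
      rw [add_mul, mul_add, mul_add, h1, h2, vecMulVec_star_mul_self hf,
        vecMulVec_star_mul_self hg]; simp)
  convert hP.add (posSemidef_vecMulVec_self_star (f - star z • g)) using 1
  ext i j
  simp only [Matrix.sub_apply, Matrix.add_apply, Matrix.smul_apply, vecMulVec_apply, smul_eq_mul,
    Pi.sub_apply, Pi.smul_apply, Pi.star_apply, star_sub, star_mul', star_star]
  linear_combination (-g i * star (g j)) * hz

/-- Reduction criterion operator of a pure state in Schmidt form. -/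
lemma isSeparableMat_trace_sub_pureMat_of_orthogonal {V : Matrix (Fin 2) (Fin N) ℂ}
    (hV : V 0 ⬝ᵥ star (V 1) = 0) :
    IsSeparableMat ((pureMat V).trace • 1 - pureMat V) := by
  obtain ⟨s, f, hsf, hs, hf, c, hc⟩ := exists_normalization (V 0)
  obtain ⟨t, g, htg, ht, hg, d, hd⟩ := exists_normalization (V 1)
  have hfg : f ⬝ᵥ star g = 0 := by rw [hc, hd]; simp [hV]
  have diag (i : Fin 2) (r : ℝ) (f : Fin N → ℂ) (hf : (f ⬝ᵥ star f) • f = f) :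
      IsSeparableMat (((r * r : ℝ) : ℂ) • (vecMulVec (Pi.single i 1) (star (Pi.single i 1)) ⊗ₖ
        (1 - vecMulVec f (star f)))) :=
    (IsSeparableMat.kronecker (posSemidef_vecMulVec_self_star _) (posSemidef_one_sub
      (isHermitian_vecMulVec_star f) (vecMulVec_star_mul_self hf))).smul (mul_self_nonneg r)
  have cross (z : ℂ) (hz : star z * z = 1) :
      IsSeparableMat (vecMulVec ![(t : ℂ), s * z] (star ![(t : ℂ), s * z]) ⊗ₖ
        (1 - z • vecMulVec f (star g) - star z • vecMulVec g (star f))) :=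
    .kronecker (posSemidef_vecMulVec_self_star _) (posSemidef_one_sub_cross hf hg hfg hz)
  have h := ((diag 0 s f hf).add (diag 1 t g hg)).add
    (((((cross 1 (by simp)).add (cross (-1) (by simp))).add (cross Complex.I (by simp))).add
      (cross (-Complex.I) (by simp))).smul (c := 1 / 4) (by norm_num))
  convert h using 1
  have htr : (pureMat V).trace = (s : ℂ) * s + t * t := by
    rw [← hs, ← ht]
    simp [pureMat, Matrix.trace, Fintype.sum_prod_type, dotProduct]
  rw [htr]
  ext ⟨i, j⟩ ⟨k, l⟩
  simp only [pureMat, Matrix.add_apply, Matrix.sub_apply, Matrix.smul_apply, smul_eq_mul,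
    kroneckerMap_apply, vecMulVec_apply, Matrix.one_apply, Prod.mk.injEq]
  by_cases hjl : j = l <;> fin_cases i <;> fin_cases k <;> simp [hsf, htg, hjl] <;> ring_nf <;>
    simp <;> ring_nf

lemma isSeparableMat_trace_sub_pureMat (V : Matrix (Fin 2) (Fin N) ℂ) :
    IsSeparableMat ((pureMat V).trace • 1 - pureMat V) := by
  have hG : (V * Vᴴ).IsHermitian := isHermitian_mul_conjTranspose_self V
  let U : Matrix (Fin 2) (Fin 2) ℂ := hG.eigenvectorUnitary
  have hU1 : Uᴴ * U = 1 := Unitary.coe_star_mul_self hG.eigenvectorUnitary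
  have hU2 : U * Uᴴ = 1 := Unitary.coe_mul_star_self hG.eigenvectorUnitary
  have hVW : V = U * (Uᴴ * V) := by rw [← Matrix.mul_assoc, hU2, Matrix.one_mul]
  have hD : (Uᴴ * V) * (Uᴴ * V)ᴴ = diagonal (fun i => (hG.eigenvalues i : ℂ)) := by
    have hS : V * Vᴴ = U * diagonal (fun i => (hG.eigenvalues i : ℂ)) * Uᴴ := hG.spectral_theorem
    calc (Uᴴ * V) * (Uᴴ * V)ᴴ = Uᴴ * (V * Vᴴ) * U := by
          simp only [conjTranspose_mul, conjTranspose_conjTranspose, Matrix.mul_assoc]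
      _ = Uᴴ * (U * diagonal (fun i => (hG.eigenvalues i : ℂ)) * Uᴴ) * U :=
          congrArg (fun X => Uᴴ * X * U) hS
      _ = (Uᴴ * U) * diagonal (fun i => (hG.eigenvalues i : ℂ)) * (Uᴴ * U) := by
          simp only [Matrix.mul_assoc]
      _ = _ := by rw [hU1, Matrix.one_mul, Matrix.mul_one]
  have horth : (Uᴴ * V) 0 ⬝ᵥ star ((Uᴴ * V) 1) = 0 := by
    have := congrFun (congrFun hD 0) 1
    rw [diagonal_apply_ne _ (by decide)] at this
    exact this
  have htr : (pureMat V).trace = (pureMat (Uᴴ * V)).trace := by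
    rw [trace_pureMat, trace_pureMat, conjTranspose_mul, conjTranspose_conjTranspose,
      trace_mul_comm (Uᴴ * V), Matrix.mul_assoc, ← Matrix.mul_assoc U, hU2, Matrix.one_mul,
      trace_mul_comm]
  have h := (isSeparableMat_trace_sub_pureMat_of_orthogonal horth).conj_kronecker_one U
  rw [mul_sub, sub_mul, ← pureMat_mul, ← hVW, ← htr, mul_smul_comm, mul_one, smul_mul_assoc,
    ← mul_kronecker_mul, hU2, mul_one, one_kronecker_one] at h
  exact h

lemma isSeparableMat_trace_sub {ρ : Matrix (Fin 2 × Fin N) (Fin 2 × Fin N) ℂ}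
    (hρ : ρ.PosSemidef) : IsSeparableMat (ρ.trace • 1 - ρ) := by
  obtain ⟨V, rfl⟩ := exists_eq_sum_pureMat hρ
  rw [trace_sum, Finset.sum_smul, ← Finset.sum_sub_distrib]
  exact .sum _ fun k _ => isSeparableMat_trace_sub_pureMat (V k)

lemma isSeparableMat_trace_sub_pureMat_sub_tildeA (V : Matrix (Fin 2) (Fin N) ℂ) :
    IsSeparableMat ((pureMat V).trace • 1 - pureMat V - tildeA (pureMat V)) := by
  obtain ⟨s, f, hsf, hs, hf, -⟩ := exists_normalization (V 0)
  obtain ⟨t, g, htg, ht, hg, -⟩ := exists_normalization (V 1)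
  have key (r : ℝ) (f : Fin N → ℂ) (hf : (f ⬝ᵥ star f) • f = f) :
      IsSeparableMat (((r * r : ℝ) : ℂ) • ((1 : Matrix (Fin 2) (Fin 2) ℂ) ⊗ₖ
        (1 - vecMulVec f (star f)))) :=
    (IsSeparableMat.kronecker .one (posSemidef_one_sub
      (isHermitian_vecMulVec_star f) (vecMulVec_star_mul_self hf))).smul (mul_self_nonneg r)
  convert (key s f hf).add (key t g hg) using 1
  have htr : (pureMat V).trace = (s : ℂ) * s + t * t := by
    rw [← hs, ← ht]
    simp [pureMat, Matrix.trace, Fintype.sum_prod_type, dotProduct]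
  rw [htr]
  ext ⟨i, j⟩ ⟨k, l⟩
  simp only [tildeA_apply, pureMat, Matrix.add_apply, Matrix.sub_apply, Matrix.smul_apply,
    smul_eq_mul, kroneckerMap_apply, vecMulVec_apply, Matrix.one_apply, Prod.mk.injEq,
    Fin.sum_univ_two]
  by_cases hjl : j = l <;> fin_cases i <;> fin_cases k <;> simp [hsf, htg, hjl] <;> ring

lemma isSeparableMat_trace_sub_sub_tildeA {ρ : Matrix (Fin 2 × Fin N) (Fin 2 × Fin N) ℂ}
    (hρ : ρ.PosSemidef) : IsSeparableMat (ρ.trace • 1 - ρ - tildeA ρ) := by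
  obtain ⟨V, rfl⟩ := exists_eq_sum_pureMat hρ
  have h : tildeA (∑ k, pureMat (V k)) = ∑ k, tildeA (pureMat (V k)) := by
    ext p q
    simp only [tildeA_apply, Matrix.sum_apply, Finset.sum_sub_distrib]
    rw [Finset.sum_comm]
    split_ifs <;> simp
  rw [h, trace_sum, Finset.sum_smul, ← Finset.sum_sub_distrib, ← Finset.sum_sub_distrib]
  exact .sum _ fun k _ => isSeparableMat_trace_sub_pureMat_sub_tildeA (V k)

lemma isSeparableMat_trace {ρ : Matrix (Fin 2 × Fin N) (Fin 2 × Fin N) ℂ}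
    (hρ : ρ.PosSemidef) : IsSeparableMat (ρ.trace • (1 : Matrix (Fin 2 × Fin N) _ ℂ)) := by
  obtain ⟨r, hr, h⟩ := RCLike.nonneg_iff_exists_ofReal.mp hρ.trace_nonneg
  rw [← h, ← one_kronecker_one]
  exact (IsSeparableMat.kronecker .one .one).smul hr

end

theorem stmt4 {N : ℕ} (hN : 1 ≤ N)
    (ρ : Matrix (Fin 2 × Fin N) (Fin 2 × Fin N) ℂ) (hρ : ρ.PosSemidef)
    (α β : ℝ) (hα : α ≥ max (-1) (β / 2 - 1)) (hβ : β ≥ max (-1) (α / 2 - 1)) :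
    IsSeparableMat
      (ρ.trace • (1 : Matrix (Fin 2 × Fin N) (Fin 2 × Fin N) ℂ)
        + (α : ℂ) • ρ + (β : ℂ) • tildeA ρ) := by
  have hα₁ : -1 ≤ α := (le_max_left _ _).trans hα
  have hα₂ : β / 2 - 1 ≤ α := (le_max_right _ _).trans hα
  have hβ₁ : -1 ≤ β := (le_max_left _ _).trans hβ
  have hβ₂ : α / 2 - 1 ≤ β := (le_max_right _ _).trans hβ
  have hT := isSeparableMat_trace hρ
  have hTR := isSeparableMat_trace_sub hρ
  have hTRS := isSeparableMat_trace_sub_sub_tildeA hρ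
  have hRS := isSeparableMat_two_smul_add_tildeA hρ
  have hTS : IsSeparableMat (ρ.trace • 1 - tildeA ρ) := by
    have h := hTR.tildeA
    rwa [sub_eq_add_neg, ← neg_one_smul ℂ ρ, tildeA_add, tildeA_smul, tildeA_smul, tildeA_one,
      neg_one_smul, ← sub_eq_add_neg] at h
  have hSR : IsSeparableMat (ρ + (2 : ℂ) • tildeA ρ) := by
    have h := hRS.tildeA
    rwa [tildeA_add, tildeA_smul, tildeA_tildeA, add_comm] at h
  generalize ρ.trace • (1 : Matrix (Fin 2 × Fin N) (Fin 2 × Fin N) ℂ) = T at *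
  generalize tildeA ρ = S at *
  have square (a b : ℝ) (ha : -1 ≤ a) (ha' : a ≤ 0) (hb : -1 ≤ b) (hb' : b ≤ 0) :
      IsSeparableMat (T + (a : ℂ) • ρ + (b : ℂ) • S) := by
    convert (((hT.smul (c := (1 + a) * (1 + b)) (by nlinarith)).add
      (hTR.smul (c := -a * (1 + b)) (by nlinarith))).add
      (hTS.smul (c := (1 + a) * -b) (by nlinarith))).add
      (hTRS.smul (c := a * b) (by nlinarith)) using 1
    push_cast
    module
  have shift (a b x y : ℝ) (ha : -1 ≤ a) (ha' : a ≤ 0) (hb : -1 ≤ b) (hb' : b ≤ 0) (hx : 0 ≤ x)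
      (hy : 0 ≤ y) (h₁ : α = a + 2 * x + y) (h₂ : β = b + x + 2 * y) :
      IsSeparableMat (T + (α : ℂ) • ρ + (β : ℂ) • S) := by
    convert ((square a b ha ha' hb hb').add (hRS.smul hx)).add (hSR.smul hy) using 1
    rw [h₁, h₂]
    push_cast
    module
  by_cases h₀ : α ≤ 0 ∧ β ≤ 0
  · exact square α β hα₁ h₀.1 hβ₁ h₀.2
  rcases le_total α (β / 2) with hA | hA
  · have : 0 ≤ β := by
      by_contra! h
      exact h₀ ⟨by linarith, h.le⟩
    exact shift (α - β / 2) 0 0 (β / 2) (by linarith) (by linarith) (by norm_num) le_rfl le_rfl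
      (by linarith) (by ring) (by ring)
  rcases le_total β (α / 2) with hB | hB
  · have : 0 ≤ α := by
      by_contra! h
      exact h₀ ⟨h.le, by linarith⟩
    exact shift 0 (β - α / 2) (α / 2) 0 (by norm_num) le_rfl (by linarith) (by linarith)
      (by linarith) le_rfl (by ring) (by ring)
  exact shift 0 0 ((2 * α - β) / 3) ((2 * β - α) / 3) (by norm_num) le_rfl (by norm_num) le_rfl
    (by linarith) (by linarith) (by ring) (by ring)
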